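/- (Exact support identification in the noiseless case.) Let Φ ∈ ℝ^{m×N} satisfy the RIP of order 2s+2 with constant δ ∈ [0,1], let μ ≥ 0, let x ∈ ℝ^N be s-sparse with x ≠ 0, set y = Φx, and let ξ denote the smallest magnitude among the nonzero entries of x. Let u ∈ ℝ^N be s-sparse and suppose ξ > √2·(|μ−1| + μδ)·‖x − u‖₂. Then for every set S′ of indices of the s largest magnitude entries of u + μΦ*(y − Φu), one has supp(x) ⊆ S′. -/

import Mathlib

open Matrix Finset

/-- The Euclidean norm of a vector in `ℝⁿ`. -/
noncomputable def norm2 {n : ℕ} (v : Fin n → ℝ) : ℝ := Real.sqrt (∑ i, (v i) ^ 2)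

/-- The support of a vector: the set of indices of its nonzero entries. -/
noncomputable def supp {n : ℕ} (v : Fin n → ℝ) : Finset (Fin n) :=
  Finset.univ.filter (fun i => v i ≠ 0)

/-- `restrict v T` keeps the entries of `v` with indices in `T` and sets all others to zero. -/
def restrict {n : ℕ} (v : Fin n → ℝ) (T : Finset (Fin n)) : Fin n → ℝ :=
  fun i => if i ∈ T then v i else 0

/-- `Φ` satisfies the restricted isometry property of order `t` with constant `δ`. -/
def RIP (m N : ℕ) (Φ : Matrix (Fin m) (Fin N) ℝ) (t : ℕ) (δ : ℝ) : Prop :=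
  ∀ v : Fin N → ℝ, (supp v).card ≤ t →
    (1 - δ) * (norm2 v) ^ 2 ≤ (norm2 (Φ.mulVec v)) ^ 2 ∧
    (norm2 (Φ.mulVec v)) ^ 2 ≤ (1 + δ) * (norm2 v) ^ 2

/-- `z` is a least-squares solution over support `T` for data `y`. -/
def IsLeastSquares {m N : ℕ} (Φ : Matrix (Fin m) (Fin N) ℝ) (y : Fin m → ℝ)
    (T : Finset (Fin N)) (z : Fin N → ℝ) : Prop :=
  supp z ⊆ T ∧ ∀ w : Fin N → ℝ, supp w ⊆ T →
    norm2 (y - Φ.mulVec z) ≤ norm2 (y - Φ.mulVec w)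

/-- `U` is a set of indices of the `k` largest magnitude entries of `v`. -/
def IsLargest {n : ℕ} (v : Fin n → ℝ) (k : ℕ) (U : Finset (Fin n)) : Prop :=
  U.card = k ∧ ∀ i ∈ U, ∀ j ∉ U, |v j| ≤ |v i|

lemma norm2_sq {n : ℕ} (v : Fin n → ℝ) : norm2 v ^ 2 = v ⬝ᵥ v := by
  unfold norm2
  rw [Real.sq_sqrt (Finset.sum_nonneg fun i _ => sq_nonneg _)]
  simp [dotProduct, sq]

lemma norm2_nonneg {n : ℕ} (v : Fin n → ℝ) : 0 ≤ norm2 v := Real.sqrt_nonneg _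

lemma cs_sq {n : ℕ} (v w : Fin n → ℝ) : (v ⬝ᵥ w) ^ 2 ≤ (v ⬝ᵥ v) * (w ⬝ᵥ w) := by
  have := Finset.sum_mul_sq_le_sq_mul_sq Finset.univ v w
  simpa [dotProduct, sq] using this

/-- Restricted near-orthogonality. -/
lemma rip_inner {m N : ℕ} (Φ : Matrix (Fin m) (Fin N) ℝ) (t : ℕ) (δ : ℝ)
    (hRIP : RIP m N Φ t δ) (w h : Fin N → ℝ)
    (hc : ∀ c : ℝ, (supp (w + c • h)).card ≤ t) :
    (Φ.mulVec w ⬝ᵥ Φ.mulVec h - w ⬝ᵥ h) ^ 2 ≤ δ ^ 2 * (w ⬝ᵥ w) * (h ⬝ᵥ h) := by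
  have key : ∀ c : ℝ, 0 ≤ (δ * (h ⬝ᵥ h)) * (c * c)
      + (-2 * (Φ.mulVec w ⬝ᵥ Φ.mulVec h - w ⬝ᵥ h)) * c + δ * (w ⬝ᵥ w) := by
    intro c
    have h1 := (hRIP _ (hc c)).2
    have h2 := (hRIP _ (hc (-c))).1
    simp only [norm2_sq, Matrix.mulVec_add, Matrix.mulVec_smul, add_dotProduct, dotProduct_add,
      smul_dotProduct, dotProduct_smul, smul_eq_mul] at h1 h2
    rw [dotProduct_comm (Φ.mulVec h) (Φ.mulVec w), dotProduct_comm h w] at h1 h2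
    nlinarith
  have := discrim_le_zero key
  unfold discrim at this
  nlinarith

lemma sign_exists (a : ℝ) : ∃ σ : ℝ, σ * σ = 1 ∧ σ * a = |a| := by
  rcases le_total 0 a with h | h
  · exact ⟨1, by norm_num, by rw [abs_of_nonneg h, one_mul]⟩
  · exact ⟨-1, by norm_num, by rw [abs_of_nonpos h]; ring⟩

theorem stmt_18 {m N : ℕ} (Φ : Matrix (Fin m) (Fin N) ℝ) (s : ℕ) (δ μ : ℝ)
    (hδ0 : 0 ≤ δ) (hδ1 : δ ≤ 1) (hμ : 0 ≤ μ)
    (hRIP : RIP m N Φ (2 * s + 2) δ)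
    (x : Fin N → ℝ) (hx : (supp x).card ≤ s) (hx0 : x ≠ 0)
    (y : Fin m → ℝ) (hy : y = Φ.mulVec x)
    (ξ : ℝ) (hξlb : ∀ i ∈ supp x, ξ ≤ |x i|) (hξmem : ∃ i ∈ supp x, |x i| = ξ)
    (u : Fin N → ℝ) (hu : (supp u).card ≤ s)
    (hgap : Real.sqrt 2 * (|μ - 1| + μ * δ) * norm2 (x - u) < ξ) :
    ∀ S' : Finset (Fin N),
      IsLargest (fun i => u i + μ * (Φᵀ.mulVec (y - Φ.mulVec u)) i) s S' →
        supp x ⊆ S' := by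
  intro S' hS' i hi
  obtain ⟨hcard, hlarge⟩ := hS'
  by_contra hiS
  obtain ⟨j, hjS, hjx⟩ : ∃ j ∈ S', j ∉ supp x := by
    by_contra hcon
    push Not at hcon
    have hsub : S' ⊆ supp x := hcon
    have := Finset.eq_of_subset_of_card_le hsub (by omega)
    exact hiS (this ▸ hi)
  have hij : i ≠ j := fun h => hiS (h ▸ hjS)
  have hxj : x j = 0 := by
    by_contra h
    exact hjx (by simp [supp, h])
  have hle := hlarge j hjS i hiS
  have hξ := hξlb i hi
  obtain ⟨w, hw⟩ : ∃ w, w = x - u := ⟨_, rfl⟩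
  have hyu : y - Φ.mulVec u = Φ.mulVec w := by rw [hy, hw, Matrix.mulVec_sub]
  rw [← hw] at hgap
  obtain ⟨e, he⟩ : ∃ e : Fin N → ℝ, e = μ • Φᵀ.mulVec (Φ.mulVec w) - w := ⟨_, rfl⟩
  have hv : ∀ k, u k + μ * (Φᵀ.mulVec (y - Φ.mulVec u)) k = x k + e k := by
    intro k
    rw [hyu, he, hw]
    simp
    ring
  simp only [hv, hxj, zero_add] at hle
  have hsum : ξ ≤ |e i| + |e j| := by
    have h1 : |x i| ≤ |x i + e i| + |e i| := by
      have := abs_sub (x i + e i) (e i)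
      simpa using this
    linarith
  obtain ⟨σ, hσ, hσe⟩ := sign_exists (e i)
  obtain ⟨τ, hτ, hτe⟩ := sign_exists (e j)
  obtain ⟨h, hh⟩ : ∃ h : Fin N → ℝ, h = Pi.single i σ + Pi.single j τ := ⟨_, rfl⟩
  have hhh : h ⬝ᵥ h = 2 := by
    rw [hh]
    simp [dotProduct_add, hij, hij.symm]
    linarith
  have heh : e ⬝ᵥ h = |e i| + |e j| := by
    rw [hh, dotProduct_add, dotProduct_single, dotProduct_single, ← hσe, ← hτe]
    ring
  have hsupp : ∀ c : ℝ, (supp (w + c • h)).card ≤ 2 * s + 2 := by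
    intro c
    have hsub : supp (w + c • h) ⊆ (supp x ∪ supp u) ∪ {i, j} := by
      intro k hk
      by_contra hk2
      simp only [Finset.mem_union, Finset.mem_insert, Finset.mem_singleton, not_or, supp,
        Finset.mem_filter, Finset.mem_univ, true_and, not_not] at hk2
      obtain ⟨⟨h1, h2⟩, h3, h4⟩ := hk2
      simp [supp, hw, hh, h1, h2, h3, h4] at hk
    have c1 := Finset.card_le_card hsub
    have c2 := Finset.card_union_le (supp x ∪ supp u) {i, j}
    have c3 := Finset.card_union_le (supp x) (supp u)
    have c4 := Finset.card_le_two (a := i) (b := j)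
    omega
  have hD := rip_inner Φ _ δ hRIP w h hsupp
  have hC := cs_sq w h
  have hr : Real.sqrt 2 ^ 2 = 2 := Real.sq_sqrt (by norm_num)
  have hr0 : 0 ≤ Real.sqrt 2 := Real.sqrt_nonneg _
  have hn0 := norm2_nonneg w
  have hD' : |Φ.mulVec w ⬝ᵥ Φ.mulVec h - w ⬝ᵥ h| ≤ δ * (Real.sqrt 2 * norm2 w) := by
    apply abs_le_of_sq_le_sq _ (by positivity)
    rw [mul_pow, mul_pow, hr, norm2_sq]
    rw [hhh] at hD
    linarith
  have hC' : |w ⬝ᵥ h| ≤ Real.sqrt 2 * norm2 w := by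
    apply abs_le_of_sq_le_sq _ (by positivity)
    rw [mul_pow, hr, norm2_sq]
    rw [hhh] at hC
    linarith
  have hexp : e ⬝ᵥ h = μ * (Φ.mulVec w ⬝ᵥ Φ.mulVec h - w ⬝ᵥ h) + (μ - 1) * (w ⬝ᵥ h) := by
    have hadj : Φᵀ.mulVec (Φ.mulVec w) ⬝ᵥ h = Φ.mulVec w ⬝ᵥ Φ.mulVec h := by
      rw [Matrix.mulVec_transpose, ← Matrix.dotProduct_mulVec]
    rw [he, sub_dotProduct, smul_dotProduct, hadj, smul_eq_mul]
    ring
  have b1 : μ * (Φ.mulVec w ⬝ᵥ Φ.mulVec h - w ⬝ᵥ h) ≤ μ * (δ * (Real.sqrt 2 * norm2 w)) :=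
    mul_le_mul_of_nonneg_left ((le_abs_self _).trans hD') hμ
  have b2 : (μ - 1) * (w ⬝ᵥ h) ≤ |μ - 1| * (Real.sqrt 2 * norm2 w) := by
    refine (le_abs_self _).trans ?_
    rw [abs_mul]
    exact mul_le_mul_of_nonneg_left hC' (abs_nonneg _)
  nlinarith
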